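/- Let Ω ⊂ ℝ² be a bounded, open, simply connected domain satisfying Assumption (R), and let ψ₀ be the scalar potential of B. If inf_Ω ψ₀ < 0, then limsup_{h→0⁺} h·log λ₋^D(h,B,Ω) ≤ 2·inf_Ω ψ₀. -/

import Mathlib

open MeasureTheory Set Filter Topology

noncomputable section

/-- First partial derivative (in the direction `x₁`) of a function on `ℝ × ℝ`. -/
def pd1 {E : Type*} [NormedAddCommGroup E] [NormedSpace ℝ E] (u : ℝ × ℝ → E) (x : ℝ × ℝ) : E :=
  fderiv ℝ u x (1, 0)

/-- Second partial derivative (in the direction `x₂`) of a function on `ℝ × ℝ`. -/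
def pd2 {E : Type*} [NormedAddCommGroup E] [NormedSpace ℝ E] (u : ℝ × ℝ → E) (x : ℝ × ℝ) : E :=
  fderiv ℝ u x (0, 1)

/-- The Laplacian on `ℝ × ℝ`. -/
def lap (ψ : ℝ × ℝ → ℝ) (x : ℝ × ℝ) : ℝ := pd1 (pd1 ψ) x + pd2 (pd2 ψ) x

/-- Test functions for the Dirichlet variational problems on `Ω`:
nonzero smooth compactly supported functions with support in `Ω`. -/
def IsTestFun (Ω : Set (ℝ × ℝ)) (u : ℝ × ℝ → ℂ) : Prop :=
  ContDiff ℝ (⊤ : ℕ∞) u ∧ HasCompactSupport u ∧ tsupport u ⊆ Ω ∧ u ≠ 0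

/-- Rayleigh quotient of the spin-`σ` (`σ = -1` : spin-down, `σ = 1` : spin-up)
Dirichlet Pauli operator at the test function `u`. -/
def pauliRayleigh (σ : ℝ) (h : ℝ) (A : ℝ × ℝ → ℝ × ℝ) (B : ℝ × ℝ → ℝ) (Ω : Set (ℝ × ℝ))
    (u : ℝ × ℝ → ℂ) : ℝ :=
  ((∫ x in Ω, (‖(h : ℂ) * pd1 u x - Complex.I * ((A x).1 : ℂ) * u x‖ ^ 2
      + ‖(h : ℂ) * pd2 u x - Complex.I * ((A x).2 : ℂ) * u x‖ ^ 2))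
    + σ * (h * ∫ x in Ω, B x * ‖u x‖ ^ 2)) / ∫ x in Ω, ‖u x‖ ^ 2

/-- The ground state energy `λ₋^D(h,A,B,Ω)` of the spin-down Dirichlet Pauli operator. -/
def lambdaMinusD (h : ℝ) (A : ℝ × ℝ → ℝ × ℝ) (B : ℝ × ℝ → ℝ) (Ω : Set (ℝ × ℝ)) : ℝ :=
  sInf (pauliRayleigh (-1) h A B Ω '' {u | IsTestFun Ω u})

/-- The ground state energy `λ₊^D(h,A,B,Ω)` of the spin-up Dirichlet Pauli operator. -/
def lambdaPlusD (h : ℝ) (A : ℝ × ℝ → ℝ × ℝ) (B : ℝ × ℝ → ℝ) (Ω : Set (ℝ × ℝ)) : ℝ :=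
  sInf (pauliRayleigh 1 h A B Ω '' {u | IsTestFun Ω u})

/-- The ground state energy `Λ^D(h,A,B,Ω)` of the full Dirichlet Pauli operator. -/
def LambdaD (h : ℝ) (A : ℝ × ℝ → ℝ × ℝ) (B : ℝ × ℝ → ℝ) (Ω : Set (ℝ × ℝ)) : ℝ :=
  min (lambdaMinusD h A B Ω) (lambdaPlusD h A B Ω)

/-- The canonical vector potential `∇⊥ψ = (−∂₂ψ, ∂₁ψ)`. -/
def perpGrad (ψ : ℝ × ℝ → ℝ) (x : ℝ × ℝ) : ℝ × ℝ := (-(pd2 ψ x), pd1 ψ x)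

/-- `ψ` is the scalar potential of `B` on `Ω`: `ψ ∈ C⁰(closure Ω) ∩ C²(Ω)`,
`Δψ = B` in `Ω` and `ψ = 0` on `∂Ω`. -/
structure IsScalarPotential (Ω : Set (ℝ × ℝ)) (B : ℝ × ℝ → ℝ) (ψ : ℝ × ℝ → ℝ) : Prop where
  contOn : ContinuousOn ψ (closure Ω)
  c2 : ContDiffOn ℝ 2 ψ Ω
  lap_eq : ∀ x ∈ Ω, lap ψ x = B x
  bdry : ∀ x ∈ frontier Ω, ψ x = 0

/-- `A` is a continuous vector potential for `B` on `Ω`: `∂₁A₂ − ∂₂A₁ = B`. -/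
def IsVectorPotential (Ω : Set (ℝ × ℝ)) (B : ℝ × ℝ → ℝ) (A : ℝ × ℝ → ℝ × ℝ) : Prop :=
  ContinuousOn A Ω ∧ ∀ x ∈ Ω, pd1 (fun y => (A y).2) x - pd2 (fun y => (A y).1) x = B x

/-- `γ` is a regular curve of class `C^{2,α}` on the parameter set `s`. -/
def C2HolderOn (α : ℝ) (γ : ℝ → ℝ × ℝ) (s : Set ℝ) : Prop :=
  ContDiffOn ℝ 2 γ s ∧
  (∃ C : ℝ, ∀ x ∈ s, ∀ y ∈ s,
      ‖derivWithin (derivWithin γ s) s x - derivWithin (derivWithin γ s) s y‖ ≤ C * |x - y| ^ α) ∧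
  ∀ x ∈ s, derivWithin γ s x ≠ 0

/-- Near `p`, the set `Γ` is a regular curve of class `C^{2,α}`. -/
def IsLocallyC2CurveAt (α : ℝ) (Γ : Set (ℝ × ℝ)) (p : ℝ × ℝ) : Prop :=
  ∃ ε > 0, ∃ γ : ℝ → ℝ × ℝ, C2HolderOn α γ (Icc (-1) 1) ∧ γ 0 = p ∧
    Γ ∩ Metric.ball p ε = γ '' Ioo (-1) 1 ∩ Metric.ball p ε

/-- `Γ` is (locally) a regular curve of class `C^{2,α}`. -/
def IsC2HolderSet (α : ℝ) (Γ : Set (ℝ × ℝ)) : Prop := ∀ p ∈ Γ, IsLocallyC2CurveAt α Γ p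

/-- `Ω` has a corner at `p` formed by two `C^{2,α}` arcs, of aperture less than `π`
(near `p`, `Ω` is contained in a strictly convex open cone with vertex `p`). -/
def HasConvexCornerAt (Ω : Set (ℝ × ℝ)) (α : ℝ) (p : ℝ × ℝ) : Prop :=
  ∃ ε > 0, (∃ γ₁ γ₂ : ℝ → ℝ × ℝ, C2HolderOn α γ₁ (Icc 0 1) ∧ C2HolderOn α γ₂ (Icc 0 1) ∧
      γ₁ 0 = p ∧ γ₂ 0 = p ∧
      frontier Ω ∩ Metric.ball p ε = (γ₁ '' Ico 0 1 ∪ γ₂ '' Ico 0 1) ∩ Metric.ball p ε) ∧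
    ∃ w : ℝ × ℝ, ∃ c > 0, ∀ x ∈ Ω ∩ Metric.ball p ε,
      c * ‖x - p‖ ≤ (x - p).1 * w.1 + (x - p).2 * w.2

/-- `Ω` has a continuous boundary which is piecewise of class `C^{2,α}` for some `α > 0`,
with at most finitely many corners, each of aperture less than `π`. -/
def HasPiecewiseC2Boundary (Ω : Set (ℝ × ℝ)) : Prop :=
  ∃ α > 0, ∃ S : Finset (ℝ × ℝ), ↑S ⊆ frontier Ω ∧
    (∀ p ∈ frontier Ω \ (S : Set (ℝ × ℝ)), IsLocallyC2CurveAt α (frontier Ω) p) ∧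
    ∀ p ∈ S, HasConvexCornerAt Ω α p

/-- Assumption (R): `Ω` is bounded and open with continuous, piecewise `C^{2,α}` boundary
having finitely many corners of aperture `< π`, and `B` extends continuously to `closure Ω`. -/
structure AssumptionR (Ω : Set (ℝ × ℝ)) (B : ℝ × ℝ → ℝ) : Prop where
  isOpen : IsOpen Ω
  bounded : Bornology.IsBounded Ω
  bdryReg : HasPiecewiseC2Boundary Ω
  fieldCont : ContinuousOn B (closure Ω)

/-- The oscillation of `ψ` over `Ω`. -/
def osc (ψ : ℝ × ℝ → ℝ) (Ω : Set (ℝ × ℝ)) : ℝ := sSup (ψ '' Ω) - sInf (ψ '' Ω)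

/-- The region enclosed by `Γ`: the union of the bounded connected components of `Γᶜ`. -/
def curveInterior (Γ : Set (ℝ × ℝ)) : Set (ℝ × ℝ) :=
  {x | x ∉ Γ ∧ Bornology.IsBounded (connectedComponentIn Γᶜ x)}

/-- `Γ` is a simple closed curve of class `C^{2,α}`. -/
def IsC2ClosedCurve (α : ℝ) (Γ : Set (ℝ × ℝ)) : Prop :=
  ∃ γ : ℝ → ℝ × ℝ, Function.Periodic γ 1 ∧ C2HolderOn α γ (Icc 0 1) ∧
    InjOn γ (Ico 0 1) ∧ Γ = γ '' Icc 0 1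

/-- The ground state energy `λ^D(Ω)` of the Dirichlet Laplacian on `Ω`. -/
def dirichletGSE (Ω : Set (ℝ × ℝ)) : ℝ :=
  sInf ((fun u : ℝ × ℝ → ℝ =>
      (∫ x in Ω, (pd1 u x ^ 2 + pd2 u x ^ 2)) / ∫ x in Ω, u x ^ 2) ''
    {u | ContDiff ℝ (⊤ : ℕ∞) u ∧ HasCompactSupport u ∧ tsupport u ⊆ Ω ∧ u ≠ 0})

/-- The open disc of radius `R` centred at the origin (with the Euclidean distance). -/
def disc (R : ℝ) : Set (ℝ × ℝ) := {y : ℝ × ℝ | y.1 ^ 2 + y.2 ^ 2 < R ^ 2}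

end


section Calculus

variable {F : Type*} [NormedAddCommGroup F] [NormedSpace ℝ F]

lemma ContDiff.continuous_pd1 {u : ℝ × ℝ → F} (hu : ContDiff ℝ 1 u) : Continuous (pd1 u) :=
  (hu.continuous_fderiv one_ne_zero).clm_apply continuous_const

lemma ContDiff.continuous_pd2 {u : ℝ × ℝ → F} (hu : ContDiff ℝ 1 u) : Continuous (pd2 u) :=
  (hu.continuous_fderiv one_ne_zero).clm_apply continuous_const

lemma ContDiff.pd1 {u : ℝ × ℝ → F} (hu : ContDiff ℝ 2 u) : ContDiff ℝ 1 (pd1 u) :=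
  (hu.fderiv_right (m := 1) (by norm_num)).clm_apply contDiff_const

lemma ContDiff.pd2 {u : ℝ × ℝ → F} (hu : ContDiff ℝ 2 u) : ContDiff ℝ 1 (pd2 u) :=
  (hu.fderiv_right (m := 1) (by norm_num)).clm_apply contDiff_const

lemma pd1_eq_zero_of_notMem_tsupport {u : ℝ × ℝ → F} {x : ℝ × ℝ} (hx : x ∉ tsupport u) :
    pd1 u x = 0 := by
  simp [_root_.pd1, fderiv_of_notMem_tsupport (𝕜 := ℝ) hx]

lemma pd2_eq_zero_of_notMem_tsupport {u : ℝ × ℝ → F} {x : ℝ × ℝ} (hx : x ∉ tsupport u) :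
    pd2 u x = 0 := by
  simp [_root_.pd2, fderiv_of_notMem_tsupport (𝕜 := ℝ) hx]

lemma HasCompactSupport.pd1 {u : ℝ × ℝ → F} (hu : HasCompactSupport u) :
    HasCompactSupport (pd1 u) := hu.fderiv_apply ℝ _

lemma HasCompactSupport.pd2 {u : ℝ × ℝ → F} (hu : HasCompactSupport u) :
    HasCompactSupport (pd2 u) := hu.fderiv_apply ℝ _

lemma pd1_add {f g : ℝ × ℝ → ℝ} {x : ℝ × ℝ} (hf : DifferentiableAt ℝ f x)
    (hg : DifferentiableAt ℝ g x) : pd1 (fun y => f y + g y) x = pd1 f x + pd1 g x := by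
  simp [_root_.pd1, fderiv_fun_add hf hg]

lemma pd2_add {f g : ℝ × ℝ → ℝ} {x : ℝ × ℝ} (hf : DifferentiableAt ℝ f x)
    (hg : DifferentiableAt ℝ g x) : pd2 (fun y => f y + g y) x = pd2 f x + pd2 g x := by
  simp [_root_.pd2, fderiv_fun_add hf hg]

lemma pd1_mul {f g : ℝ × ℝ → ℝ} {x : ℝ × ℝ} (hf : DifferentiableAt ℝ f x)
    (hg : DifferentiableAt ℝ g x) :
    pd1 (fun y => f y * g y) x = pd1 f x * g x + f x * pd1 g x := by
  simp only [_root_.pd1, fderiv_fun_mul hf hg]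
  simp; ring

lemma pd2_mul {f g : ℝ × ℝ → ℝ} {x : ℝ × ℝ} (hf : DifferentiableAt ℝ f x)
    (hg : DifferentiableAt ℝ g x) :
    pd2 (fun y => f y * g y) x = pd2 f x * g x + f x * pd2 g x := by
  simp only [_root_.pd2, fderiv_fun_mul hf hg]
  simp; ring

lemma pd1_pd2_comm {f : ℝ × ℝ → ℝ} (hf : ContDiff ℝ 2 f) (x : ℝ × ℝ) :
    pd1 (pd2 f) x = pd2 (pd1 f) x := by
  have hd : DifferentiableAt ℝ (fderiv ℝ f) x :=
    (hf.fderiv_right (m := 1) (by norm_num)).contDiffAt.differentiableAt one_ne_zero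
  have key : ∀ v w : ℝ × ℝ, fderiv ℝ (fun y => fderiv ℝ f y v) x w
      = fderiv ℝ (fderiv ℝ f) x w v := by
    intro v w
    rw [fderiv_clm_apply hd (differentiableAt_const v)]
    simp
  have hs : IsSymmSndFDerivAt ℝ f x := hf.contDiffAt.isSymmSndFDerivAt (by simp)
  exact (key _ _).trans ((hs.eq _ _).trans (key _ _).symm)

lemma integral_pd_eq_zero {g : ℝ × ℝ → ℝ} (hg : ContDiff ℝ 1 g) (hc : HasCompactSupport g)
    (v : ℝ × ℝ) : ∫ x, fderiv ℝ g x v = 0 := by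
  have h := integral_mul_fderiv_eq_neg_fderiv_mul_of_integrable (𝕜 := ℝ)
    (μ := (volume : Measure (ℝ × ℝ))) (f := fun _ => (1 : ℝ)) (g := g) (v := v) (by simp)
    (by simpa using ((hg.continuous_fderiv one_ne_zero).clm_apply
      continuous_const).integrable_of_hasCompactSupport (hc.fderiv_apply ℝ v))
    (by simpa using hg.continuous.integrable_of_hasCompactSupport hc)
    (fun x _ => differentiableAt_const _)
    (fun x _ => hg.contDiffAt.differentiableAt one_ne_zero)
  simpa using h

lemma integrable_pd1 {g : ℝ × ℝ → ℝ} (hg : ContDiff ℝ 1 g) (hc : HasCompactSupport g) :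
    Integrable (pd1 g) := hg.continuous_pd1.integrable_of_hasCompactSupport hc.pd1

lemma integrable_pd2 {g : ℝ × ℝ → ℝ} (hg : ContDiff ℝ 1 g) (hc : HasCompactSupport g) :
    Integrable (pd2 g) := hg.continuous_pd2.integrable_of_hasCompactSupport hc.pd2

lemma integral_pd1_eq_zero {g : ℝ × ℝ → ℝ} (hg : ContDiff ℝ 1 g) (hc : HasCompactSupport g) :
    ∫ x, pd1 g x = 0 := integral_pd_eq_zero hg hc _

lemma integral_pd2_eq_zero {g : ℝ × ℝ → ℝ} (hg : ContDiff ℝ 1 g) (hc : HasCompactSupport g) :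
    ∫ x, pd2 g x = 0 := integral_pd_eq_zero hg hc _

lemma contDiff_re {n : WithTop ℕ∞} {u : ℝ × ℝ → ℂ} (hu : ContDiff ℝ n u) :
    ContDiff ℝ n (fun x => (u x).re) := Complex.reCLM.contDiff.comp hu

lemma contDiff_im {n : WithTop ℕ∞} {u : ℝ × ℝ → ℂ} (hu : ContDiff ℝ n u) :
    ContDiff ℝ n (fun x => (u x).im) := Complex.imCLM.contDiff.comp hu

lemma fderiv_re_apply {u : ℝ × ℝ → ℂ} {x : ℝ × ℝ} (hu : DifferentiableAt ℝ u x) (v : ℝ × ℝ) :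
    fderiv ℝ (fun y => (u y).re) x v = (fderiv ℝ u x v).re := by
  have := (Complex.reCLM.hasFDerivAt.comp x hu.hasFDerivAt).fderiv
  simpa [Function.comp_def] using DFunLike.congr_fun this v

lemma fderiv_im_apply {u : ℝ × ℝ → ℂ} {x : ℝ × ℝ} (hu : DifferentiableAt ℝ u x) (v : ℝ × ℝ) :
    fderiv ℝ (fun y => (u y).im) x v = (fderiv ℝ u x v).im := by
  have := (Complex.imCLM.hasFDerivAt.comp x hu.hasFDerivAt).fderiv
  simpa [Function.comp_def] using DFunLike.congr_fun this v

end Calculus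

/-- The annihilation-type operator `h(∂₁ + i∂₂) + (∂₁φ + i∂₂φ)`, whose squared `L²` norm
is the quadratic form of the spin-down Pauli operator with vector potential `∇⊥φ`. -/
noncomputable def annihilate (h : ℝ) (φ : ℝ × ℝ → ℝ) (u : ℝ × ℝ → ℂ) (x : ℝ × ℝ) : ℂ :=
  ((h : ℂ) * pd1 u x + ((pd1 φ x : ℝ) : ℂ) * u x)
    + Complex.I * ((h : ℂ) * pd2 u x + ((pd2 φ x : ℝ) : ℂ) * u x)

/-- The kinetic energy density of `u` in the vector potential `A`. -/
noncomputable def kineticDensity (h : ℝ) (A : ℝ × ℝ → ℝ × ℝ) (u : ℝ × ℝ → ℂ) (x : ℝ × ℝ) : ℝ :=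
  ‖(h : ℂ) * pd1 u x - Complex.I * ((A x).1 : ℂ) * u x‖ ^ 2
    + ‖(h : ℂ) * pd2 u x - Complex.I * ((A x).2 : ℂ) * u x‖ ^ 2

section Pauli

variable {h : ℝ} {φ : ℝ × ℝ → ℝ} {u : ℝ × ℝ → ℂ}

lemma kineticDensity_sub_norm_annihilate_sq (hφ : ContDiff ℝ 2 φ) (hu : ContDiff ℝ 2 u)
    (x : ℝ × ℝ) :
    kineticDensity h (perpGrad φ) u x - h * (lap φ x * ‖u x‖ ^ 2)
        - ‖annihilate h φ u x‖ ^ 2 =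
      -h * (pd1 (fun y => pd1 φ y * ((u y).re * (u y).re + (u y).im * (u y).im)) x
        + pd2 (fun y => pd2 φ y * ((u y).re * (u y).re + (u y).im * (u y).im)) x)
      - 2 * h ^ 2 * (pd2 (fun y => (u y).re * pd1 (fun z => (u z).im) y) x
        - pd1 (fun y => (u y).re * pd2 (fun z => (u z).im) y) x) := by
  have ha : ContDiff ℝ 2 (fun y => (u y).re) := contDiff_re hu
  have hb : ContDiff ℝ 2 (fun y => (u y).im) := contDiff_im hu
  have d : ∀ {f : ℝ × ℝ → ℝ}, ContDiff ℝ 2 f → DifferentiableAt ℝ f x := fun hf =>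
    hf.contDiffAt.differentiableAt two_ne_zero
  have d1 : ∀ {f : ℝ × ℝ → ℝ}, ContDiff ℝ 1 f → DifferentiableAt ℝ f x := fun hf =>
    hf.contDiffAt.differentiableAt one_ne_zero
  have hsq : DifferentiableAt ℝ (fun y => (u y).re * (u y).re + (u y).im * (u y).im) x :=
    ((d ha).mul (d ha)).add ((d hb).mul (d hb))
  have e1 : pd1 (fun y => (u y).re * (u y).re + (u y).im * (u y).im) x
      = pd1 (fun y => (u y).re * (u y).re) x + pd1 (fun y => (u y).im * (u y).im) x :=
    pd1_add ((d ha).mul (d ha)) ((d hb).mul (d hb))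
  have e2 : pd2 (fun y => (u y).re * (u y).re + (u y).im * (u y).im) x
      = pd2 (fun y => (u y).re * (u y).re) x + pd2 (fun y => (u y).im * (u y).im) x :=
    pd2_add ((d ha).mul (d ha)) ((d hb).mul (d hb))
  have hud : DifferentiableAt ℝ u x := hu.contDiffAt.differentiableAt two_ne_zero
  have r1 : pd1 (fun y => (u y).re) x = (pd1 u x).re := fderiv_re_apply hud _
  have r2 : pd2 (fun y => (u y).re) x = (pd2 u x).re := fderiv_re_apply hud _
  have i1 : pd1 (fun y => (u y).im) x = (pd1 u x).im := fderiv_im_apply hud _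
  have i2 : pd2 (fun y => (u y).im) x = (pd2 u x).im := fderiv_im_apply hud _
  rw [pd1_mul (d1 hφ.pd1) hsq, pd2_mul (d1 hφ.pd2) hsq, e1, e2, pd1_mul (d ha) (d ha),
    pd2_mul (d ha) (d ha), pd1_mul (d hb) (d hb), pd2_mul (d hb) (d hb),
    pd2_mul (d ha) (d1 hb.pd1), pd1_mul (d ha) (d1 hb.pd2), pd1_pd2_comm hb, r1, r2, i1, i2]
  simp only [kineticDensity, annihilate, perpGrad, lap, ← Complex.normSq_eq_norm_sq,
    Complex.normSq_apply]
  simp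
  ring

lemma integrable_norm_annihilate_sq (hφ : ContDiff ℝ 2 φ) (hu : ContDiff ℝ 2 u)
    (hc : HasCompactSupport u) : Integrable (fun x => ‖annihilate h φ u x‖ ^ 2) := by
  have hu1 : ContDiff ℝ 1 u := hu.of_le (by norm_num)
  have cu : Continuous u := hu.continuous
  have cu1 := hu1.continuous_pd1
  have cu2 := hu1.continuous_pd2
  have cφ1 := hφ.pd1.continuous
  have cφ2 := hφ.pd2.continuous
  apply Continuous.integrable_of_hasCompactSupport
  · unfold annihilate; fun_prop
  · refine HasCompactSupport.intro hc fun x hx => ?_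
    simp [annihilate, image_eq_zero_of_notMem_tsupport hx, pd1_eq_zero_of_notMem_tsupport hx,
      pd2_eq_zero_of_notMem_tsupport hx]

lemma integral_kineticDensity_sub (hφ : ContDiff ℝ 2 φ) (hu : ContDiff ℝ 2 u)
    (hc : HasCompactSupport u) :
    (∫ x, kineticDensity h (perpGrad φ) u x) - h * ∫ x, lap φ x * ‖u x‖ ^ 2
      = ∫ x, ‖annihilate h φ u x‖ ^ 2 := by
  have ha : ContDiff ℝ 2 (fun y => (u y).re) := contDiff_re hu
  have hb : ContDiff ℝ 2 (fun y => (u y).im) := contDiff_im hu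
  have hac : HasCompactSupport (fun y => (u y).re) := hc.comp_left (g := Complex.re) rfl
  have hbc : HasCompactSupport (fun y => (u y).im) := hc.comp_left (g := Complex.im) rfl
  have hu1 : ContDiff ℝ 1 u := hu.of_le (by norm_num)
  have ha1 := ha.of_le (m := 1) (by norm_num)
  have hb1 := hb.of_le (m := 1) (by norm_num)
  have hsq := (ha1.mul ha1).add (hb1.mul hb1)
  have hsqc : HasCompactSupport (fun y => (u y).re * (u y).re + (u y).im * (u y).im) :=
    (hac.mul_left (f := fun y => (u y).re)).add (hbc.mul_left (f := fun y => (u y).im))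
  have g1 := hφ.pd1.mul hsq
  have g2 := hφ.pd2.mul hsq
  have g3 := ha1.mul hb.pd1
  have g4 := ha1.mul hb.pd2
  have c1 : HasCompactSupport
      (fun y => pd1 φ y * ((u y).re * (u y).re + (u y).im * (u y).im)) := hsqc.mul_left
  have c2 : HasCompactSupport
      (fun y => pd2 φ y * ((u y).re * (u y).re + (u y).im * (u y).im)) := hsqc.mul_left
  have c3 : HasCompactSupport (fun y => (u y).re * pd1 (fun z => (u z).im) y) := hac.mul_right
  have c4 : HasCompactSupport (fun y => (u y).re * pd2 (fun z => (u z).im) y) := hac.mul_right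
  have cu : Continuous u := hu.continuous
  have cu1 := hu1.continuous_pd1
  have cu2 := hu1.continuous_pd2
  have cφ1 := hφ.pd1.continuous
  have cφ2 := hφ.pd2.continuous
  have off : ∀ x ∉ tsupport u, u x = 0 ∧ pd1 u x = 0 ∧ pd2 u x = 0 := fun x hx =>
    ⟨image_eq_zero_of_notMem_tsupport hx, pd1_eq_zero_of_notMem_tsupport hx,
      pd2_eq_zero_of_notMem_tsupport hx⟩
  have iK : Integrable (kineticDensity h (perpGrad φ) u) := by
    apply Continuous.integrable_of_hasCompactSupport
    · unfold kineticDensity perpGrad; fun_prop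
    · refine HasCompactSupport.intro hc fun x hx => ?_
      obtain ⟨h0, h1, h2⟩ := off x hx
      simp [kineticDensity, h0, h1, h2]
  have iL : Integrable (fun x => lap φ x * ‖u x‖ ^ 2) := by
    apply Continuous.integrable_of_hasCompactSupport
    · have := hφ.pd1.continuous_pd1
      have := hφ.pd2.continuous_pd2
      unfold lap; fun_prop
    · refine HasCompactSupport.intro hc fun x hx => ?_
      simp [(off x hx).1]
  have iN := integrable_norm_annihilate_sq (h := h) hφ hu hc
  have key := integral_congr_ae (μ := (volume : Measure (ℝ × ℝ))) (.of_forall fun x =>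
    kineticDensity_sub_norm_annihilate_sq (h := h) hφ hu x)
  have i12 := ((integrable_pd1 g1 c1).add (integrable_pd2 g2 c2)).const_mul (-h)
  have i34 := ((integrable_pd2 g3 c3).sub (integrable_pd1 g4 c4)).const_mul (2 * h ^ 2)
  rw [integral_sub (by exact iK.sub (iL.const_mul h)) iN, integral_sub iK (iL.const_mul h),
    integral_const_mul, integral_sub (by exact i12) (by exact i34), integral_const_mul,
    integral_const_mul, integral_add (integrable_pd1 g1 c1) (integrable_pd2 g2 c2),
    integral_sub (integrable_pd2 g3 c3) (integrable_pd1 g4 c4),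
    integral_pd1_eq_zero g1 c1, integral_pd2_eq_zero g2 c2, integral_pd2_eq_zero g3 c3,
    integral_pd1_eq_zero g4 c4] at key
  linarith

end Pauli

section Poincare

lemma integrable_norm_sq {f : ℝ × ℝ → ℂ} (hf : Continuous f) (hc : HasCompactSupport f) :
    Integrable (fun x => ‖f x‖ ^ 2) := by
  apply Continuous.integrable_of_hasCompactSupport
  · fun_prop
  · exact HasCompactSupport.intro hc fun x hx => by simp [image_eq_zero_of_notMem_tsupport hx]

lemma integral_norm_sq_le_integral_norm_pd1_sq {v : ℝ × ℝ → ℂ} {R : ℝ} (hv : ContDiff ℝ 1 v)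
    (hc : HasCompactSupport v) (hR : ∀ x ∈ tsupport v, |x.1| ≤ R) :
    ∫ x, ‖v x‖ ^ 2 ≤ 4 * R ^ 2 * ∫ x, ‖pd1 v x‖ ^ 2 := by
  have ha : ContDiff ℝ 1 (fun y => (v y).re) := contDiff_re hv
  have hb : ContDiff ℝ 1 (fun y => (v y).im) := contDiff_im hv
  have hac : HasCompactSupport (fun y => (v y).re) := hc.comp_left (g := Complex.re) rfl
  have hbc : HasCompactSupport (fun y => (v y).im) := hc.comp_left (g := Complex.im) rfl
  have hsq := (ha.mul ha).add (hb.mul hb)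
  have hsqc : HasCompactSupport (fun y => (v y).re * (v y).re + (v y).im * (v y).im) :=
    (hac.mul_left (f := fun y => (v y).re)).add (hbc.mul_left (f := fun y => (v y).im))
  have hg : ContDiff ℝ 1
      (fun y => y.1 * ((v y).re * (v y).re + (v y).im * (v y).im)) := contDiff_fst.mul hsq
  have hgc : HasCompactSupport
      (fun y => y.1 * ((v y).re * (v y).re + (v y).im * (v y).im)) := hsqc.mul_left
  have alg : ∀ a b p q t : ℝ, t ^ 2 ≤ R ^ 2 → a * a + b * b - 4 * R ^ 2 * (p * p + q * q)
      ≤ 2 * (1 * (a * a + b * b) + t * (p * a + a * p + (q * b + b * q))) := fun a b p q t ht => by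
    nlinarith [sq_nonneg (a + 2 * t * p), sq_nonneg (b + 2 * t * q),
      mul_nonneg (sub_nonneg.2 ht) (sq_nonneg p), mul_nonneg (sub_nonneg.2 ht) (sq_nonneg q)]
  have hpt : ∀ x, ‖v x‖ ^ 2 - 4 * R ^ 2 * ‖pd1 v x‖ ^ 2
      ≤ 2 * pd1 (fun y => y.1 * ((v y).re * (v y).re + (v y).im * (v y).im)) x := by
    intro x
    by_cases hx : x ∈ tsupport v
    · have hvd : DifferentiableAt ℝ v x := hv.contDiffAt.differentiableAt one_ne_zero
      have hda : DifferentiableAt ℝ (fun y => (v y).re) x :=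
        ha.contDiffAt.differentiableAt one_ne_zero
      have hdb : DifferentiableAt ℝ (fun y => (v y).im) x :=
        hb.contDiffAt.differentiableAt one_ne_zero
      have r1 : pd1 (fun y => (v y).re) x = (pd1 v x).re := fderiv_re_apply hvd _
      have i1 : pd1 (fun y => (v y).im) x = (pd1 v x).im := fderiv_im_apply hvd _
      have e1 : pd1 (fun y => (v y).re * (v y).re + (v y).im * (v y).im) x
          = pd1 (fun y => (v y).re * (v y).re) x + pd1 (fun y => (v y).im * (v y).im) x :=
        pd1_add (hda.mul hda) (hdb.mul hdb)
      have f1 : pd1 (fun y : ℝ × ℝ => y.1) x = 1 := by simp [pd1, fderiv_fst]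
      have hx1 : x.1 ^ 2 ≤ R ^ 2 := sq_le_sq' (neg_le_of_abs_le (hR x hx))
        (le_of_abs_le (hR x hx))
      rw [pd1_mul differentiableAt_fst (hsq.contDiffAt.differentiableAt one_ne_zero),
        e1, pd1_mul hda hda, pd1_mul hdb hdb, r1, i1, f1]
      simp only [← Complex.normSq_eq_norm_sq, Complex.normSq_apply]
      exact alg _ _ _ _ _ hx1
    · have h0 : (fun y : ℝ × ℝ => y.1 * ((v y).re * (v y).re + (v y).im * (v y).im))
          =ᶠ[𝓝 x] fun _ => 0 := by
        filter_upwards [(isClosed_tsupport v).isOpen_compl.mem_nhds hx] with y hy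
        simp [image_eq_zero_of_notMem_tsupport hy]
      have h1 : pd1 (fun y : ℝ × ℝ => y.1 * ((v y).re * (v y).re + (v y).im * (v y).im)) x = 0 := by
        simp [pd1, h0.fderiv_eq]
      rw [h1, pd1_eq_zero_of_notMem_tsupport hx, image_eq_zero_of_notMem_tsupport hx]
      simp
  have iv : Integrable (fun x => ‖v x‖ ^ 2) :=
    integrable_norm_sq hv.continuous hc
  have ip : Integrable (fun x => ‖pd1 v x‖ ^ 2) :=
    integrable_norm_sq hv.continuous_pd1 hc.pd1
  have key := integral_mono (iv.sub (ip.const_mul (4 * R ^ 2)))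
    ((integrable_pd1 hg hgc).const_mul 2) hpt
  rw [integral_const_mul, integral_pd1_eq_zero hg hgc] at key
  simp only [Pi.sub_apply] at key
  rw [integral_sub iv (ip.const_mul _), integral_const_mul] at key
  linarith

end Poincare

section Cutoff

lemma exists_contDiff_cutoff {K Ω : Set (ℝ × ℝ)} (hK : IsCompact K) (hΩ : IsOpen Ω)
    (hKΩ : K ⊆ Ω) : ∃ χ : ℝ × ℝ → ℝ, ContDiff ℝ (⊤ : ℕ∞) χ ∧ HasCompactSupport χ ∧
      tsupport χ ⊆ Ω ∧ ∀ x ∈ K, χ =ᶠ[𝓝 x] 1 := by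
  obtain ⟨L, hL, hKL, hLΩ⟩ := exists_compact_between hK hΩ hKΩ
  obtain ⟨f, h1, h0, -⟩ := exists_contMDiffMap_one_nhds_of_subset_interior
    (n := (⊤ : ℕ∞)) (modelWithCornersSelf ℝ (ℝ × ℝ)) hK.isClosed hKL
  have hsupp : tsupport f ⊆ L := closure_minimal
    (fun x hx => by by_contra hxL; exact hx (h0 x hxL)) hL.isClosed
  exact ⟨f, f.contMDiff.contDiff, hL.of_isClosed_subset (isClosed_tsupport _) hsupp,
    hsupp.trans hLΩ, fun x hx => h1.filter_mono (nhds_le_nhdsSet hx)⟩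

lemma exists_contDiff_eventuallyEq {K Ω : Set (ℝ × ℝ)} {ψ : ℝ × ℝ → ℝ} (hK : IsCompact K)
    (hΩ : IsOpen Ω) (hKΩ : K ⊆ Ω) (hψ : ContDiffOn ℝ 2 ψ Ω) :
    ∃ φ : ℝ × ℝ → ℝ, ContDiff ℝ 2 φ ∧ HasCompactSupport φ ∧ ∀ x ∈ K, φ =ᶠ[𝓝 x] ψ := by
  obtain ⟨χ, hχ, hχc, hχΩ, hχ1⟩ := exists_contDiff_cutoff hK hΩ hKΩ
  refine ⟨fun x => χ x * ψ x, ?_, hχc.mul_right, fun x hx => ?_⟩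
  · rw [contDiff_iff_contDiffAt]
    intro x
    by_cases hx : x ∈ tsupport χ
    · exact (hχ.of_le (WithTop.coe_le_coe.2 (le_top : (2 : ℕ∞) ≤ ⊤))).contDiffAt.mul
        (hψ.contDiffAt (hΩ.mem_nhds (hχΩ hx)))
    · have : (fun x => χ x * ψ x) =ᶠ[𝓝 x] fun _ => 0 := by
        filter_upwards [(isClosed_tsupport χ).isOpen_compl.mem_nhds hx] with y hy
        rw [image_eq_zero_of_notMem_tsupport hy, zero_mul]
      exact contDiffAt_const.congr_of_eventuallyEq this
  · filter_upwards [hχ1 x hx] with y hy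
    simp [hy]

end Cutoff

section Mollification

lemma exists_contDiff_approx_fderiv {g : ℝ × ℝ → ℝ} (hg : ContDiff ℝ 1 g)
    (hc : HasCompactSupport g) {ε : ℝ} (hε : 0 < ε) :
    ∃ f : ℝ × ℝ → ℝ, ContDiff ℝ (⊤ : ℕ∞) f ∧ (∀ x, |f x - g x| ≤ ε) ∧
      ∀ x, ‖fderiv ℝ f x - fderiv ℝ g x‖ ≤ ε := by
  have hg' : Continuous (fderiv ℝ g) := hg.continuous_fderiv one_ne_zero
  have u0 := hc.uniformContinuous_of_continuous hg.continuous
  have u1 := (hc.fderiv ℝ).uniformContinuous_of_continuous hg'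
  obtain ⟨δ₀, hδ₀, h0⟩ := Metric.uniformContinuous_iff.1 u0 ε hε
  obtain ⟨δ₁, hδ₁, h1⟩ := Metric.uniformContinuous_iff.1 u1 ε hε
  have hδ : 0 < min δ₀ δ₁ := lt_min hδ₀ hδ₁
  let b : ContDiffBump (0 : ℝ × ℝ) := ⟨min δ₀ δ₁ / 2, min δ₀ δ₁, half_pos hδ, half_lt_self hδ⟩
  have hb : b.rOut = min δ₀ δ₁ := rfl
  let f : ℝ × ℝ → ℝ := convolution (b.normed volume) g (ContinuousLinearMap.lsmul ℝ ℝ) volume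
  have hbl : LocallyIntegrable (b.normed (volume : Measure (ℝ × ℝ))) volume :=
    b.continuous_normed.locallyIntegrable
  have hf' : ∀ x, HasFDerivAt f (convolution (b.normed volume) (fderiv ℝ g)
      (ContinuousLinearMap.lsmul ℝ ℝ) volume x) x := fun x =>
    hc.hasFDerivAt_convolution_right (ContinuousLinearMap.lsmul ℝ ℝ) hbl hg x
  refine ⟨f, b.hasCompactSupport_normed.contDiff_convolution_left _ b.contDiff_normed
    hg.continuous.locallyIntegrable, fun x => ?_, fun x => ?_⟩
  · refine b.dist_normed_convolution_le hg.continuous.aestronglyMeasurable fun y hy => ?_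
    exact (h0 (lt_of_lt_of_le hy (min_le_left _ _))).le
  · rw [(hf' x).fderiv, ← dist_eq_norm]
    refine b.dist_normed_convolution_le hg'.aestronglyMeasurable fun y hy => ?_
    exact (h1 (lt_of_lt_of_le hy (min_le_right _ _))).le

lemma exists_contDiff_approx {g : ℝ × ℝ → ℝ} (hg : ContDiff ℝ 1 g)
    (hc : HasCompactSupport g) {ε : ℝ} (hε : 0 < ε) :
    ∃ f : ℝ × ℝ → ℝ, ContDiff ℝ (⊤ : ℕ∞) f ∧ (∀ x, |f x - g x| ≤ ε) ∧
      (∀ x, |pd1 f x - pd1 g x| ≤ ε) ∧ ∀ x, |pd2 f x - pd2 g x| ≤ ε := by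
  obtain ⟨f, hf, h0, h1⟩ := exists_contDiff_approx_fderiv hg hc hε
  refine ⟨f, hf, h0, fun x => ?_, fun x => ?_⟩
  · refine ((fderiv ℝ f x - fderiv ℝ g x).le_opNorm (1, 0)).trans ?_
    simpa [Prod.norm_def] using h1 x
  · refine ((fderiv ℝ f x - fderiv ℝ g x).le_opNorm (0, 1)).trans ?_
    simpa [Prod.norm_def] using h1 x

end Mollification

section Gauge

lemma pd1_exp_smul {h : ℝ} (θ : ℝ × ℝ → ℝ) (v : ℝ × ℝ → ℂ) {x : ℝ × ℝ}
    (hθ : DifferentiableAt ℝ θ x) (hv : DifferentiableAt ℝ v x) :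
    pd1 (fun y => Real.exp (-θ y / h) • v y) x
      = Real.exp (-θ x / h) • (pd1 v x - (pd1 θ x / h) • v x) := by
  have he : HasFDerivAt (fun y => Real.exp (-θ y / h))
      (Real.exp (-θ x / h) • (h⁻¹ • -fderiv ℝ θ x)) x := by
    simpa only [div_eq_mul_inv] using (hθ.hasFDerivAt.fun_neg.mul_const h⁻¹).exp
  have := (he.smul hv.hasFDerivAt).fderiv
  simp only [pd1]
  erw [this]
  simp [div_eq_mul_inv]
  ring

lemma pd2_exp_smul {h : ℝ} (θ : ℝ × ℝ → ℝ) (v : ℝ × ℝ → ℂ) {x : ℝ × ℝ}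
    (hθ : DifferentiableAt ℝ θ x) (hv : DifferentiableAt ℝ v x) :
    pd2 (fun y => Real.exp (-θ y / h) • v y) x
      = Real.exp (-θ x / h) • (pd2 v x - (pd2 θ x / h) • v x) := by
  have he : HasFDerivAt (fun y => Real.exp (-θ y / h))
      (Real.exp (-θ x / h) • (h⁻¹ • -fderiv ℝ θ x)) x := by
    simpa only [div_eq_mul_inv] using (hθ.hasFDerivAt.fun_neg.mul_const h⁻¹).exp
  have := (he.smul hv.hasFDerivAt).fderiv
  simp only [pd2]
  erw [this]
  simp [div_eq_mul_inv]
  ring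

lemma annihilate_exp_smul {h : ℝ} (hh : h ≠ 0) (φ θ : ℝ × ℝ → ℝ) (v : ℝ × ℝ → ℂ) {x : ℝ × ℝ}
    (hθ : DifferentiableAt ℝ θ x) (hv : DifferentiableAt ℝ v x) :
    annihilate h φ (fun y => Real.exp (-θ y / h) • v y) x
      = Real.exp (-θ x / h) • (h * (pd1 v x + Complex.I * pd2 v x)
        + ((pd1 φ x - pd1 θ x : ℝ) + Complex.I * (pd2 φ x - pd2 θ x : ℝ)) * v x) := by
  have hh' : (h : ℂ) ≠ 0 := by exact_mod_cast hh
  rw [annihilate, pd1_exp_smul θ v hθ hv, pd2_exp_smul θ v hθ hv]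
  simp only [Complex.real_smul]
  push_cast
  field_simp
  ring

lemma integral_norm_dbar_sq {v : ℝ × ℝ → ℂ} (hv : ContDiff ℝ 2 v) (hc : HasCompactSupport v) :
    ∫ x, ‖pd1 v x + Complex.I * pd2 v x‖ ^ 2 = ∫ x, (‖pd1 v x‖ ^ 2 + ‖pd2 v x‖ ^ 2) := by
  have h1 : pd1 (fun _ : ℝ × ℝ => (0 : ℝ)) = fun _ => 0 := by ext; simp [pd1]
  have h2 : pd2 (fun _ : ℝ × ℝ => (0 : ℝ)) = fun _ => 0 := by ext; simp [pd2]
  have h := integral_kineticDensity_sub (h := 1) (φ := fun _ => 0) contDiff_const hv hc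
  simpa [kineticDensity, perpGrad, annihilate, lap, h1, h2] using h.symm

end Gauge

section Rayleigh

variable {Ω : Set (ℝ × ℝ)} {B ψ φ : ℝ × ℝ → ℝ} {u : ℝ × ℝ → ℂ} {h : ℝ}

lemma pauliRayleigh_neg_one_eq (hψ : IsScalarPotential Ω B ψ) (hφ : ContDiff ℝ 2 φ)
    (hu : IsTestFun Ω u) (hφψ : ∀ x ∈ tsupport u, φ =ᶠ[𝓝 x] ψ) :
    pauliRayleigh (-1) h (perpGrad ψ) B Ω u
      = (∫ x, ‖annihilate h φ u x‖ ^ 2) / ∫ x, ‖u x‖ ^ 2 := by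
  obtain ⟨hu, hc, hs, -⟩ := hu
  have hu2 : ContDiff ℝ 2 u := hu.of_le (WithTop.coe_le_coe.2 (le_top : (2 : ℕ∞) ≤ ⊤))
  have off : ∀ x ∉ tsupport u, u x = 0 ∧ pd1 u x = 0 ∧ pd2 u x = 0 := fun x hx =>
    ⟨image_eq_zero_of_notMem_tsupport hx, pd1_eq_zero_of_notMem_tsupport hx,
      pd2_eq_zero_of_notMem_tsupport hx⟩
  have hfd : ∀ x ∈ tsupport u, fderiv ℝ φ =ᶠ[𝓝 x] fderiv ℝ ψ := fun x hx => (hφψ x hx).fderiv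
  have hp1 : ∀ x ∈ tsupport u, pd1 φ =ᶠ[𝓝 x] pd1 ψ := fun x hx =>
    (hfd x hx).fun_comp (fun L => L (1, 0))
  have hp2 : ∀ x ∈ tsupport u, pd2 φ =ᶠ[𝓝 x] pd2 ψ := fun x hx =>
    (hfd x hx).fun_comp (fun L => L (0, 1))
  have e1 : ∫ x in Ω, kineticDensity h (perpGrad ψ) u x
      = ∫ x, kineticDensity h (perpGrad φ) u x := by
    rw [setIntegral_eq_integral_of_forall_compl_eq_zero]
    · refine integral_congr_ae (.of_forall fun x => ?_)
      by_cases hx : x ∈ tsupport u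
      · simp only [kineticDensity, perpGrad, (hp1 x hx).eq_of_nhds, (hp2 x hx).eq_of_nhds]
      · obtain ⟨h0, h1, h2⟩ := off x hx
        simp [kineticDensity, h0, h1, h2]
    · intro x hx
      obtain ⟨h0, h1, h2⟩ := off x (fun hx' => hx (hs hx'))
      simp [kineticDensity, h0, h1, h2]
  have e2 : ∫ x in Ω, B x * ‖u x‖ ^ 2 = ∫ x, lap φ x * ‖u x‖ ^ 2 := by
    rw [setIntegral_eq_integral_of_forall_compl_eq_zero]
    · refine integral_congr_ae (.of_forall fun x => ?_)
      by_cases hx : x ∈ tsupport u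
      · have hl : lap φ x = lap ψ x := by
          simp only [lap]
          rw [pd1, pd2, (hp1 x hx).fderiv_eq, (hp2 x hx).fderiv_eq]; rfl
        simp only [hl, hψ.lap_eq x (hs hx)]
      · simp [(off x hx).1]
    · intro x hx
      simp [(off x (fun hx' => hx (hs hx'))).1]
  have e3 : ∫ x in Ω, ‖u x‖ ^ 2 = ∫ x, ‖u x‖ ^ 2 := by
    rw [setIntegral_eq_integral_of_forall_compl_eq_zero]
    intro x hx
    simp [(off x (fun hx' => hx (hs hx'))).1]
  have key := integral_kineticDensity_sub (h := h) hφ hu2 hc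
  rw [← key, ← e1, ← e2, ← e3, pauliRayleigh, neg_one_mul, ← sub_eq_add_neg]
  rfl

lemma IsTestFun.integral_norm_sq_pos (hu : IsTestFun Ω u) : 0 < ∫ x, ‖u x‖ ^ 2 := by
  obtain ⟨hu, hc, -, h0⟩ := hu
  obtain ⟨x, hx⟩ := Function.ne_iff.1 h0
  have hcont : Continuous fun x => ‖u x‖ ^ 2 := by
    have := hu.continuous
    fun_prop
  have hcs : HasCompactSupport fun x => ‖u x‖ ^ 2 :=
    HasCompactSupport.intro hc fun y hy => by simp [image_eq_zero_of_notMem_tsupport hy]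
  exact hcont.integral_pos_of_hasCompactSupport_nonneg_nonzero hcs (fun y => by positivity)
    (x := x) (by simpa using hx)

lemma le_pauliRayleigh_neg_one (hΩ : IsOpen Ω) (hψ : IsScalarPotential Ω B ψ) {M R : ℝ}
    (hM : ∀ x ∈ Ω, |ψ x| ≤ M) (hR0 : 0 < R) (hR : ∀ x ∈ Ω, |x.1| ≤ R) (hh : 0 < h)
    (hu : IsTestFun Ω u) :
    (4 * R ^ 2)⁻¹ * h ^ 2 * Real.exp (-(4 * M) / h)
      ≤ pauliRayleigh (-1) h (perpGrad ψ) B Ω u := by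
  obtain ⟨φ, hφ, -, hφψ⟩ := exists_contDiff_eventuallyEq hu.2.1 hΩ hu.2.2.1 hψ.c2
  rw [pauliRayleigh_neg_one_eq hψ hφ hu hφψ, le_div_iff₀ hu.integral_norm_sq_pos]
  obtain ⟨hu, hc, hs, -⟩ := hu
  have hu2 : ContDiff ℝ 2 u := hu.of_le (WithTop.coe_le_coe.2 (le_top : (2 : ℕ∞) ≤ ⊤))
  set v : ℝ × ℝ → ℂ := fun x => Real.exp (φ x / h) • u x with hv
  have he : ContDiff ℝ 2 fun x => Real.exp (φ x / h) := (hφ.div_const h).exp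
  have hv2 : ContDiff ℝ 2 v := he.smul hu2
  have hvs : tsupport v ⊆ tsupport u := tsupport_smul_subset_right (fun x => Real.exp (φ x / h)) u
  have hvc : HasCompactSupport v := hc.of_isClosed_subset (isClosed_tsupport v) hvs
  have huv : u = fun x => Real.exp (-φ x / h) • v x := by
    ext x
    simp [hv, ← mul_assoc, ← Complex.exp_add, neg_div]
  have hφM : ∀ x ∈ tsupport u, |φ x| ≤ M := fun x hx => by
    rw [(hφψ x hx).eq_of_nhds]; exact hM x (hs hx)
  have hD : ∀ x, h ^ 2 * Real.exp (-(2 * M) / h) * ‖pd1 v x + Complex.I * pd2 v x‖ ^ 2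
      ≤ ‖annihilate h φ u x‖ ^ 2 := by
    intro x
    by_cases hx : x ∈ tsupport v
    · have := annihilate_exp_smul hh.ne' φ φ v (hφ.contDiffAt.differentiableAt two_ne_zero)
        (hv2.contDiffAt.differentiableAt two_ne_zero) (x := x)
      rw [← huv] at this
      rw [this]
      simp only [sub_self, Complex.ofReal_zero, mul_zero, add_zero, zero_mul, norm_smul, norm_mul,
        mul_pow, Complex.norm_real, Real.norm_eq_abs, sq_abs, ← Real.exp_nat_mul]
      rw [← mul_assoc, mul_comm (h ^ 2)]
      gcongr
      rw [mul_div_assoc']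
      gcongr
      have := le_of_abs_le (hφM x (hvs hx))
      push_cast
      linarith
    · rw [pd1_eq_zero_of_notMem_tsupport hx, pd2_eq_zero_of_notMem_tsupport hx]
      simp
  have hU : ∀ x, Real.exp (-(2 * M) / h) * ‖u x‖ ^ 2 ≤ ‖v x‖ ^ 2 := by
    intro x
    by_cases hx : x ∈ tsupport u
    · simp only [hv, norm_smul, mul_pow, Real.norm_eq_abs, sq_abs, ← Real.exp_nat_mul]
      gcongr
      rw [mul_div_assoc']
      gcongr
      have := neg_le_of_abs_le (hφM x hx)
      push_cast
      linarith
    · rw [image_eq_zero_of_notMem_tsupport hx]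
      simp
  have hv1 : ContDiff ℝ 1 v := hv2.of_le (by norm_num)
  have ip1 := integrable_norm_sq hv1.continuous_pd1 hvc.pd1
  have ip2 := integrable_norm_sq hv1.continuous_pd2 hvc.pd2
  have idb : Integrable (fun x => ‖pd1 v x + Complex.I * pd2 v x‖ ^ 2) :=
    integrable_norm_sq (f := fun x => pd1 v x + Complex.I * pd2 v x)
      (hv1.continuous_pd1.add (continuous_const.mul hv1.continuous_pd2))
      (hvc.pd1.add hvc.pd2.mul_left)
  have s1 := integral_mono (idb.const_mul _) (integrable_norm_annihilate_sq hφ hu2 hc) hD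
  have s2 := integral_mono ((integrable_norm_sq hu.continuous hc).const_mul _)
    (integrable_norm_sq hv2.continuous hvc) hU
  have s3 := integral_norm_sq_le_integral_norm_pd1_sq hv1 hvc
    (fun x hx => hR x (hs (hvs hx)))
  have s4 : ∫ x, ‖pd1 v x‖ ^ 2 ≤ ∫ x, ‖pd1 v x + Complex.I * pd2 v x‖ ^ 2 := by
    rw [integral_norm_dbar_sq hv2 hvc]
    exact integral_mono ip1 (ip1.add ip2) fun x => le_add_of_nonneg_right (by positivity)
  rw [integral_const_mul] at s1 s2
  have hexp : Real.exp (-(4 * M) / h) = Real.exp (-(2 * M) / h) * Real.exp (-(2 * M) / h) := by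
    rw [← Real.exp_add]; ring_nf
  calc (4 * R ^ 2)⁻¹ * h ^ 2 * Real.exp (-(4 * M) / h) * ∫ x, ‖u x‖ ^ 2
      = h ^ 2 * Real.exp (-(2 * M) / h)
        * ((4 * R ^ 2)⁻¹ * (Real.exp (-(2 * M) / h) * ∫ x, ‖u x‖ ^ 2)) := by rw [hexp]; ring
    _ ≤ h ^ 2 * Real.exp (-(2 * M) / h)
        * ∫ x, ‖pd1 v x + Complex.I * pd2 v x‖ ^ 2 := by
      gcongr
      rw [inv_mul_le_iff₀ (by positivity)]
      exact s2.trans (s3.trans (by gcongr))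
    _ ≤ _ := s1

end Rayleigh

section TrialState

variable {Ω : Set (ℝ × ℝ)} {B ψ : ℝ × ℝ → ℝ}

lemma norm_annihilate_exp_smul_sq_le {h a ε : ℝ} (hh : 0 < h) {φ θ : ℝ × ℝ → ℝ}
    {v : ℝ × ℝ → ℂ} {x : ℝ × ℝ} (hθ : DifferentiableAt ℝ θ x) (hv : DifferentiableAt ℝ v x)
    (h1 : |pd1 θ x - pd1 φ x| ≤ ε) (h2 : |pd2 θ x - pd2 φ x| ≤ ε) (ha : a ≤ θ x) :
    ‖annihilate h φ (fun y => Real.exp (-θ y / h) • v y) x‖ ^ 2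
      ≤ Real.exp (-(2 * a) / h)
        * (2 * (h ^ 2 * ‖pd1 v x + Complex.I * pd2 v x‖ ^ 2 + 4 * ε ^ 2 * ‖v x‖ ^ 2)) := by
  rw [annihilate_exp_smul hh.ne' φ θ v hθ hv, norm_smul, mul_pow, Real.norm_eq_abs, sq_abs,
    ← Real.exp_nat_mul]
  set w := pd1 v x + Complex.I * pd2 v x
  have hε : ‖((pd1 φ x - pd1 θ x : ℝ) : ℂ) + Complex.I * (pd2 φ x - pd2 θ x : ℝ)‖ ≤ 2 * ε := by
    refine (norm_add_le _ _).trans ?_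
    rw [norm_mul, Complex.norm_I, one_mul, Complex.norm_real, Complex.norm_real, Real.norm_eq_abs,
      Real.norm_eq_abs, abs_sub_comm, abs_sub_comm (pd2 φ x)]
    linarith
  have hn : ‖h * w + (((pd1 φ x - pd1 θ x : ℝ) : ℂ) + Complex.I * (pd2 φ x - pd2 θ x : ℝ)) * v x‖
      ≤ h * ‖w‖ + 2 * ε * ‖v x‖ := by
    refine (norm_add_le _ _).trans ?_
    rw [norm_mul, norm_mul, Complex.norm_real, Real.norm_eq_abs, abs_of_pos hh]
    gcongr
  gcongr
  · rw [mul_div_assoc']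
    gcongr
    push_cast
    linarith
  · refine (pow_le_pow_left₀ (norm_nonneg _) hn 2).trans ?_
    nlinarith [sq_nonneg (h * ‖w‖ - 2 * ε * ‖v x‖)]

lemma exists_isTestFun_pauliRayleigh_le (hΩ : IsOpen Ω) (hb : Bornology.IsBounded Ω)
    (hψ : IsScalarPotential Ω B ψ) {m δ : ℝ} (hm : ∀ x ∈ Ω, m ≤ ψ x) (hδ : 0 < δ)
    (hmδ : m + δ ≤ -δ) (hne : ∃ x ∈ Ω, ψ x < m + δ) :
    ∃ C > 0, ∀ h ∈ Ioo (0 : ℝ) 1, ∃ u, IsTestFun Ω u ∧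
      pauliRayleigh (-1) h (perpGrad ψ) B Ω u ≤ C * Real.exp ((2 * m + 4 * δ) / h) := by
  set K : Set (ℝ × ℝ) := closure Ω ∩ ψ ⁻¹' Iic (-δ) with hKdef
  have hK : IsCompact K := hb.isCompact_closure.of_isClosed_subset
    (hψ.contOn.preimage_isClosed_of_isClosed isClosed_closure isClosed_Iic) inter_subset_left
  have hKΩ : K ⊆ Ω := by
    rintro x ⟨hx, hxδ⟩
    by_contra hxΩ
    have h0 := hψ.bdry x ⟨hx, by rwa [hΩ.interior_eq]⟩
    simp only [mem_preimage, mem_Iic, h0] at hxδ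
    linarith
  obtain ⟨χ, hχ, hχc, hχΩ, hχ1⟩ := exists_contDiff_cutoff hK hΩ hKΩ
  obtain ⟨φ, hφ, hφc, hφψ⟩ := exists_contDiff_eventuallyEq hχc hΩ hχΩ hψ.c2
  set v : ℝ × ℝ → ℂ := fun x => (χ x : ℂ) with hvdef
  have hv : ContDiff ℝ (⊤ : ℕ∞) v := Complex.ofRealCLM.contDiff.comp hχ
  have hv1 : ContDiff ℝ 1 v := hv.of_le (WithTop.coe_le_coe.2 (le_top : (1 : ℕ∞) ≤ ⊤))
  have hvχ : tsupport v ⊆ tsupport χ := closure_mono fun x hx => by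
    simpa [hvdef] using hx
  have hvc : HasCompactSupport v := hχc.of_isClosed_subset (isClosed_tsupport v) hvχ
  have hvK : ∀ x ∈ K, pd1 v x = 0 ∧ pd2 v x = 0 ∧ v x = 1 := by
    intro x hx
    have he : v =ᶠ[𝓝 x] fun _ => 1 := by
      filter_upwards [hχ1 x hx] with y hy
      simp [hvdef, hy]
    simp [pd1, pd2, he.fderiv_eq, he.eq_of_nhds]
  set U : Set (ℝ × ℝ) := Ω ∩ ψ ⁻¹' Iio (m + δ) with hUdef
  have hU : IsOpen U := hψ.c2.continuousOn.isOpen_inter_preimage hΩ isOpen_Iio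
  have hUK : U ⊆ K := fun x hx => ⟨subset_closure hx.1, by
    have := hx.2
    simp only [mem_preimage, mem_Iio, mem_Iic] at this ⊢
    linarith⟩
  have hUfin : volume U ≠ ⊤ := ((measure_mono hUK).trans_lt hK.measure_lt_top).ne
  have hV : 0 < volume.real U :=
    ENNReal.toReal_pos (hU.measure_pos volume hne).ne' hUfin
  set g : ℝ × ℝ → ℝ := fun x => ‖pd1 v x + Complex.I * pd2 v x‖ ^ 2 + 4 * ‖v x‖ ^ 2 with hg
  have hgi : Integrable g := by
    have idb : Integrable (fun x => ‖pd1 v x + Complex.I * pd2 v x‖ ^ 2) :=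
      integrable_norm_sq (f := fun x => pd1 v x + Complex.I * pd2 v x)
        (hv1.continuous_pd1.add (continuous_const.mul hv1.continuous_pd2))
        (hvc.pd1.add hvc.pd2.mul_left)
    exact idb.add ((integrable_norm_sq hv.continuous hvc).const_mul 4)
  have hg0 : ∀ x, 0 ≤ g x := fun x => by positivity
  have hJ : 0 ≤ ∫ x, g x := integral_nonneg hg0
  refine ⟨2 * Real.exp 4 * (∫ x, g x) / volume.real U + 1, by positivity, fun h hh => ?_⟩
  obtain ⟨hh0, hh1⟩ := hh
  set ε := h * Real.exp (m / h) with hε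
  have hε0 : 0 < ε := by positivity
  have hεh : ε ≤ h := mul_le_of_le_one_right hh0.le
    (Real.exp_le_one_iff.2 (div_nonpos_of_nonpos_of_nonneg (by linarith) hh0.le))
  obtain ⟨θ, hθ, hθφ, hθ1, hθ2⟩ := exists_contDiff_approx (hφ.of_le (by norm_num)) hφc hε0
  set u : ℝ × ℝ → ℂ := fun x => Real.exp (-θ x / h) • v x with hu
  have hu_smooth : ContDiff ℝ (⊤ : ℕ∞) u := by
    have : ContDiff ℝ (⊤ : ℕ∞) fun x => Real.exp (-θ x / h) := (hθ.neg.div_const h).exp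
    exact this.smul hv
  have huv : tsupport u ⊆ tsupport v :=
    tsupport_smul_subset_right (fun x => Real.exp (-θ x / h)) v
  have huc : HasCompactSupport u := hvc.of_isClosed_subset (isClosed_tsupport u) huv
  have htest : IsTestFun Ω u := by
    refine ⟨hu_smooth, huc, (huv.trans hvχ).trans hχΩ, fun h0 => ?_⟩
    obtain ⟨x, hx⟩ := hne
    have := congrFun h0 x
    simp [hu, (hvK x (hUK hx)).2.2] at this
  have hu2 : ContDiff ℝ 2 u := hu_smooth.of_le (WithTop.coe_le_coe.2 (le_top : (2 : ℕ∞) ≤ ⊤))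
  have hθd : ∀ x, DifferentiableAt ℝ θ x := fun x =>
    hθ.contDiffAt.differentiableAt (by simp)
  have hvd : ∀ x, DifferentiableAt ℝ v x := fun x => hv1.contDiffAt.differentiableAt one_ne_zero
  have hεdiv : 2 * ε / h ≤ 2 := by
    rw [div_le_iff₀ hh0]
    linarith
  have hnum : ∀ x, ‖annihilate h φ u x‖ ^ 2
      ≤ Real.exp (2 * δ / h) * (2 * Real.exp 2) * g x := by
    intro x
    by_cases hx : x ∈ tsupport v
    · have hxφ : φ x = ψ x := (hφψ x (hvχ hx)).eq_of_nhds
      have hxθ := abs_le.1 (hθφ x)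
      by_cases hxK : x ∈ K
      · have ha : m - ε ≤ θ x := by
          have := hm x (hKΩ hxK)
          linarith
        refine (norm_annihilate_exp_smul_sq_le hh0 (hθd x) (hvd x) (hθ1 x) (hθ2 x) ha).trans ?_
        obtain ⟨e1, e2, -⟩ := hvK x hxK
        have hexp : Real.exp (-(2 * (m - ε)) / h) * ε ^ 2 = Real.exp (2 * ε / h) * h ^ 2 := by
          rw [show -(2 * (m - ε)) / h = 2 * ε / h - 2 * (m / h) by ring, Real.exp_sub, hε, mul_pow,
            ← Real.exp_nat_mul]
          push_cast
          field_simp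
        simp only [hg, e1, e2, mul_zero, add_zero, norm_zero, ne_eq, OfNat.ofNat_ne_zero,
          not_false_eq_true, zero_pow, zero_add]
        calc _ = 8 * ‖v x‖ ^ 2 * (Real.exp (-(2 * (m - ε)) / h) * ε ^ 2) := by ring
          _ = 8 * ‖v x‖ ^ 2 * (1 * (Real.exp (2 * ε / h) * h ^ 2)) := by rw [hexp, one_mul]
          _ ≤ 8 * ‖v x‖ ^ 2 * (Real.exp (2 * δ / h) * (Real.exp 2 * 1 ^ 2)) := by
            gcongr
            exact Real.one_le_exp (by positivity)
          _ = _ := by ring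
      · have hxδ : -δ < ψ x := by
          by_contra! hc
          exact hxK ⟨subset_closure (hχΩ (hvχ hx)), hc⟩
        have ha : -δ - ε ≤ θ x := by linarith
        refine (norm_annihilate_exp_smul_sq_le hh0 (hθd x) (hvd x) (hθ1 x) (hθ2 x) ha).trans ?_
        rw [show -(2 * (-δ - ε)) / h = 2 * δ / h + 2 * ε / h by ring, Real.exp_add]
        calc _ ≤ Real.exp (2 * δ / h) * Real.exp 2 * (2 * (1 ^ 2 *
              ‖pd1 v x + Complex.I * pd2 v x‖ ^ 2 + 4 * 1 ^ 2 * ‖v x‖ ^ 2)) := by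
              gcongr
              linarith
          _ = _ := by rw [hg]; ring
    · have hx' : x ∉ tsupport u := fun hc => hx (huv hc)
      rw [annihilate, pd1_eq_zero_of_notMem_tsupport hx', pd2_eq_zero_of_notMem_tsupport hx',
        image_eq_zero_of_notMem_tsupport hx']
      have := hg0 x
      simp only [mul_zero, add_zero, norm_zero, ne_eq, OfNat.ofNat_ne_zero, not_false_eq_true,
        zero_pow]
      positivity
  have hui := integrable_norm_sq hu_smooth.continuous huc
  have hden : Real.exp (-2) * Real.exp (-(2 * (m + δ)) / h) * volume.real U
      ≤ ∫ x, ‖u x‖ ^ 2 := by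
    refine le_trans ?_ (setIntegral_le_integral (s := U) hui (.of_forall fun x => by positivity))
    rw [mul_comm, ← smul_eq_mul, ← setIntegral_const]
    refine setIntegral_mono_on (integrableOn_const hUfin) hui.integrableOn hU.measurableSet ?_
    intro x hx
    have hx1 := (hvK x (hUK hx)).2.2
    have hxs : x ∈ tsupport v := subset_tsupport v (by simp [hx1])
    have hxφ : φ x = ψ x := (hφψ x (hvχ hxs)).eq_of_nhds
    have hxθ := abs_le.1 (hθφ x)
    have hxU : ψ x < m + δ := hx.2
    rw [hu, norm_smul, mul_pow, hx1, norm_one, one_pow, mul_one, Real.norm_eq_abs, sq_abs,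
      ← Real.exp_nat_mul, ← Real.exp_add]
    gcongr
    rw [mul_div_assoc', le_div_iff₀ hh0, add_mul, div_mul_cancel₀ _ hh0.ne']
    push_cast
    linarith
  refine ⟨u, htest, ?_⟩
  rw [pauliRayleigh_neg_one_eq hψ hφ htest fun x hx => hφψ x (hvχ (huv hx)),
    div_le_iff₀ htest.integral_norm_sq_pos]
  have hbound := integral_mono (integrable_norm_annihilate_sq hφ hu2 huc) (hgi.const_mul _) hnum
  rw [integral_const_mul] at hbound
  have hexp : Real.exp (2 * δ / h) * Real.exp (-2) = Real.exp ((2 * m + 4 * δ) / h)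
      * (Real.exp (-2) * Real.exp (-(2 * (m + δ)) / h)) := by
    rw [← Real.exp_add, ← Real.exp_add, ← Real.exp_add]
    ring_nf
  have hexp4 : Real.exp 2 = Real.exp 4 * Real.exp (-2) := by
    rw [← Real.exp_add]
    norm_num
  calc _ ≤ Real.exp (2 * δ / h) * (2 * Real.exp 2) * ∫ x, g x := hbound
    _ = 2 * Real.exp 4 * (∫ x, g x) / volume.real U * Real.exp ((2 * m + 4 * δ) / h)
        * (Real.exp (-2) * Real.exp (-(2 * (m + δ)) / h) * volume.real U) := by
      have hVV : volume.real U * (volume.real U)⁻¹ = 1 := mul_inv_cancel₀ hV.ne'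
      rw [hexp4, div_eq_mul_inv _ (volume.real U)]
      linear_combination (2 * Real.exp 4 * ∫ x, g x) * hexp - (2 * Real.exp 4 * ∫ x, g x)
        * Real.exp ((2 * m + 4 * δ) / h) * Real.exp (-2) * Real.exp (-(2 * (m + δ)) / h) * hVV
    _ ≤ _ := by
      gcongr
      linarith

end TrialState

/-- Theorem 2.1 / `th1.3ga`: if `inf_Ω ψ₀ < 0` then
`limsup_{h→0⁺} h·log λ₋^D(h,B,Ω) ≤ 2·inf_Ω ψ₀`. -/
theorem pauli_limsup_le_of_inf_neg (Ω : Set (ℝ × ℝ)) (B ψ₀ : ℝ × ℝ → ℝ)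
    (hR : AssumptionR Ω B) (hsc : SimplyConnectedSpace Ω)
    (hψ : IsScalarPotential Ω B ψ₀) (hneg : sInf (ψ₀ '' Ω) < 0) :
    limsup (fun h : ℝ => h * Real.log (lambdaMinusD h (perpGrad ψ₀) B Ω)) (𝓝[>] 0)
      ≤ 2 * sInf (ψ₀ '' Ω) := by
  have hΩ := hR.isOpen
  have hΩb := hR.bounded
  set m := sInf (ψ₀ '' Ω) with hm
  obtain ⟨M, hM⟩ := hΩb.isCompact_closure.exists_bound_of_continuousOn hψ.contOn
  have hM' : ∀ x ∈ Ω, |ψ₀ x| ≤ M := fun x hx => hM x (subset_closure hx)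
  obtain ⟨R₀, hR₀⟩ := hΩb.exists_norm_le
  set R := max R₀ 1
  have hRpos : 0 < R := lt_max_of_lt_right one_pos
  have hR' : ∀ x ∈ Ω, |x.1| ≤ R := fun x hx =>
    (norm_fst_le x).trans ((hR₀ x hx).trans (le_max_left _ _))
  have himne : (ψ₀ '' Ω).Nonempty := by
    by_contra hc
    rw [not_nonempty_iff_eq_empty] at hc
    rw [hm, hc, Real.sInf_empty] at hneg
    exact hneg.false
  have himbdd : BddBelow (ψ₀ '' Ω) := ⟨-M, by
    rintro _ ⟨x, hx, rfl⟩
    exact neg_le_of_abs_le (hM' x hx)⟩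
  have hmle : ∀ x ∈ Ω, m ≤ ψ₀ x := fun x hx => csInf_le himbdd (mem_image_of_mem _ hx)
  have hup : ∀ δ > 0, m + δ ≤ -δ → ∃ C > 0, ∀ h ∈ Ioo (0 : ℝ) 1, ∃ u, IsTestFun Ω u ∧
      pauliRayleigh (-1) h (perpGrad ψ₀) B Ω u ≤ C * Real.exp ((2 * m + 4 * δ) / h) := by
    intro δ hδ hmδ
    obtain ⟨_, ⟨x, hx, rfl⟩, hlt⟩ := exists_lt_of_csInf_lt himne (lt_add_of_pos_right m hδ)
    exact exists_isTestFun_pauliRayleigh_le hΩ hΩb hψ hmle hδ hmδ ⟨x, hx, hlt⟩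
  set c := (4 * R ^ 2)⁻¹
  have hc : 0 < c := by positivity
  have hlow : ∀ h > 0, ∀ y ∈ pauliRayleigh (-1) h (perpGrad ψ₀) B Ω '' {u | IsTestFun Ω u},
      c * h ^ 2 * Real.exp (-(4 * M) / h) ≤ y := by
    rintro h hh _ ⟨u, hu, rfl⟩
    exact le_pauliRayleigh_neg_one hΩ hψ hM' hRpos hR' hh hu
  obtain ⟨C₀, -, hC₀⟩ := hup (-m / 2) (by linarith) (by linarith)
  have hlam : ∀ h ∈ Ioo (0 : ℝ) 1, c * h ^ 2 * Real.exp (-(4 * M) / h)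
      ≤ lambdaMinusD h (perpGrad ψ₀) B Ω := fun h hh => by
    obtain ⟨u, hu, -⟩ := hC₀ h hh
    exact le_csInf ⟨_, mem_image_of_mem _ hu⟩ (hlow h hh.1)
  have hIoo : Ioo (0 : ℝ) 1 ∈ 𝓝[>] (0 : ℝ) := Ioo_mem_nhdsGT one_pos
  have hbelow : ∀ᶠ h in 𝓝[>] (0 : ℝ), -|Real.log c| - 2 - 4 * M
      ≤ h * Real.log (lambdaMinusD h (perpGrad ψ₀) B Ω) := by
    filter_upwards [hIoo] with h hh
    have hh0 : 0 < h := hh.1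
    have hlog := Real.log_le_log (by positivity) (hlam h hh)
    rw [Real.log_mul (by positivity) (by positivity), Real.log_mul hc.ne' (by positivity),
      Real.log_exp, Real.log_pow] at hlog
    have h1 := mul_le_mul_of_nonneg_left hlog hh0.le
    have h2 : h * (-(4 * M) / h) = -(4 * M) := mul_div_cancel₀ _ hh0.ne'
    have h3 : -1 ≤ h * Real.log h := by
      have := Real.one_sub_inv_le_log_of_pos hh0
      have := mul_le_mul_of_nonneg_left this hh0.le
      rw [mul_sub, mul_inv_cancel₀ hh0.ne'] at this
      linarith
    have h4 : -|Real.log c| ≤ h * Real.log c := by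
      have := neg_le_of_abs_le (le_refl |h * Real.log c|)
      rw [abs_mul, abs_of_pos hh0] at this
      nlinarith [abs_nonneg (Real.log c), hh.2]
    push_cast at h1
    linarith
  have hcob : IsCoboundedUnder (· ≤ ·) (𝓝[>] (0 : ℝ))
      (fun h => h * Real.log (lambdaMinusD h (perpGrad ψ₀) B Ω)) :=
    IsBoundedUnder.isCoboundedUnder_le ⟨_, hbelow⟩
  refine le_of_forall_pos_le_add fun ε hε => ?_
  set δ := min (ε / 5) (-m / 2)
  have hδ : 0 < δ := lt_min (by linarith) (by linarith)
  have hδε : δ ≤ ε / 5 := min_le_left _ _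
  have hδm : δ ≤ -m / 2 := min_le_right _ _
  obtain ⟨C, hC, hCu⟩ := hup δ hδ (by linarith)
  have hsmall : ∀ᶠ h in 𝓝[>] (0 : ℝ), h * Real.log C < δ := by
    have : Tendsto (fun h : ℝ => h * Real.log C) (𝓝 0) (𝓝 0) := by
      simpa using (tendsto_id (α := ℝ) (x := 𝓝 0)).mul_const (Real.log C)
    exact (this.mono_left nhdsWithin_le_nhds).eventually_lt_const hδ
  refine limsup_le_of_le hcob ?_
  filter_upwards [hIoo, hsmall] with h hh hs
  have hh0 : 0 < h := hh.1
  obtain ⟨u, hu, hle⟩ := hCu h hh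
  have hle' : lambdaMinusD h (perpGrad ψ₀) B Ω ≤ C * Real.exp ((2 * m + 4 * δ) / h) :=
    (csInf_le ⟨_, hlow h hh0⟩ (mem_image_of_mem _ hu)).trans hle
  have hpos : 0 < lambdaMinusD h (perpGrad ψ₀) B Ω :=
    lt_of_lt_of_le (by positivity) (hlam h hh)
  have hlog := Real.log_le_log hpos hle'
  rw [Real.log_mul hC.ne' (by positivity), Real.log_exp] at hlog
  have h1 := mul_le_mul_of_nonneg_left hlog hh0.le
  rw [mul_add, mul_div_cancel₀ _ hh0.ne'] at h1
  linarith
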